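/- Let D be a Γ-invariant linear operator on compactly supported sections of finite propagation speed, Γ' a finite-index normal subgroup of Γ, S a set of representatives of the Γ-orbits in Y, and z ∈ ℂ. Then tr e^{zD_{Γ'}} = [Γ:Γ'] · Σ_{s∈S} Σ_{γ∈Γ'} tr(ρ(γ)⁻¹⟨γs|e^{zD}|s⟩), and consequently tr e^{zD_{Γ'}}/[Γ:Γ'] − tr_Γ e^{zD} = Σ_{s∈S} Σ_{γ∈Γ', γ≠1} tr(ρ(γ)⁻¹⟨γs|e^{zD}|s⟩). -/

import Mathlib

open scoped BigOperators
open Filter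

noncomputable section

variable {Y Γ V : Type*}

section Defs

variable [Group Γ] [MulAction Γ Y]
variable [NormedAddCommGroup V] [InnerProductSpace ℂ V]

/-- The action of `γ ∈ Γ` on compactly (= finitely) supported sections
`φ : Y →₀ V`, given by `(γ · φ)(y) = ρ(γ) φ(γ⁻¹ • y)`. -/
def secAct (ρ : Γ →* (V ≃ₗᵢ[ℂ] V)) (γ : Γ) (φ : Y →₀ V) : Y →₀ V :=
  Finsupp.equivMapDomain (MulAction.toPerm γ) (φ.mapRange (ρ γ) ((ρ γ).map_zero))

/-- A linear operator on compactly supported sections is `Γ`-invariant if it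
commutes with the action of `Γ`. -/
def IsEquivariantOp (ρ : Γ →* (V ≃ₗᵢ[ℂ] V)) (D : (Y →₀ V) →ₗ[ℂ] (Y →₀ V)) : Prop :=
  ∀ (γ : Γ) (φ : Y →₀ V), D (secAct ρ γ φ) = secAct ρ γ (D φ)

/-- The kernel `⟨x|D|y⟩ ∈ End(V)` of an operator `D`, characterized by
`⟨x|D|y⟩ v = (D δ_{y,v})(x)`. -/
def kernelOf (D : (Y →₀ V) →ₗ[ℂ] (Y →₀ V)) (x y : Y) : V →ₗ[ℂ] V :=
  (Finsupp.lapply x) ∘ₗ D ∘ₗ (Finsupp.lsingle y)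

/-- `D` has finite propagation speed `≤ R`:
`supp (Dφ) ⊆ U_R(supp φ) = {x | ∃ y ∈ supp φ, d(x,y) ≤ R}`. -/
def HasPropSpeed [MetricSpace Y] (D : (Y →₀ V) →ₗ[ℂ] (Y →₀ V)) (R : ℝ) : Prop :=
  ∀ (φ : Y →₀ V) (x : Y), D φ x ≠ 0 → ∃ y ∈ φ.support, dist x y ≤ R

/-- A set of representatives of the orbits of a group `G` acting on `Y`:
it contains exactly one point of every orbit. -/
def IsRepSet (G : Type*) [Group G] [MulAction G Y] (S : Set Y) : Prop :=
  ∀ y : Y, ∃! s, s ∈ S ∧ s ∈ MulAction.orbit G y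

/-- The space `W_{Γ'}` of `Γ'`-equivariant functions `f : Y → V`,
i.e. `f(γ • y) = ρ(γ) f(y)` for all `γ ∈ Γ'`. -/
def equivSubmodule (ρ : Γ →* (V ≃ₗᵢ[ℂ] V)) (Γ' : Subgroup Γ) : Submodule ℂ (Y → V) where
  carrier := {f | ∀ (γ : Γ') (y : Y), f ((γ : Γ) • y) = ρ (γ : Γ) (f y)}
  add_mem' := by intro f g hf hg γ y; simp only [Pi.add_apply, hf γ y, hg γ y, map_add]
  zero_mem' := by intro γ y; simp
  smul_mem' := by intro c f hf γ y; simp only [Pi.smul_apply, hf γ y, map_smul]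

/-- The summation map `S_{Γ'} φ (y) = Σ_{γ ∈ Γ'} ρ(γ)⁻¹ φ(γ • y)`. -/
def smap (ρ : Γ →* (V ≃ₗᵢ[ℂ] V)) (Γ' : Subgroup Γ) (φ : Y →₀ V) : Y → V :=
  fun y => ∑ᶠ γ : Γ', ρ ((γ : Γ)⁻¹) (φ ((γ : Γ) • y))

/-- `DG` is the pushdown of `D` to `W_{Γ'}`, i.e. `DG ∘ S_{Γ'} = S_{Γ'} ∘ D`. -/
def IsPushdown (ρ : Γ →* (V ≃ₗᵢ[ℂ] V)) (Γ' : Subgroup Γ)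
    (D : (Y →₀ V) →ₗ[ℂ] (Y →₀ V))
    (DG : equivSubmodule (Y := Y) ρ Γ' →ₗ[ℂ] equivSubmodule (Y := Y) ρ Γ') : Prop :=
  ∀ (w : equivSubmodule (Y := Y) ρ Γ') (φ : Y →₀ V),
    (w : Y → V) = smap ρ Γ' φ → ((DG w : Y → V) = smap ρ Γ' (D φ))

/-- The kernel `⟨x|D|y⟩`, as a continuous linear map on `V`. -/
def kernelOfL [FiniteDimensional ℂ V] (D : (Y →₀ V) →ₗ[ℂ] (Y →₀ V)) (x y : Y) : V →L[ℂ] V :=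
  LinearMap.toContinuousLinearMap (kernelOf D x y)

/-- The heat kernel `⟨x|e^{zD}|y⟩ = Σ_{n ≥ 0} (zⁿ/n!) ⟨x|Dⁿ|y⟩`. -/
def heatKer [FiniteDimensional ℂ V] (D : (Y →₀ V) →ₗ[ℂ] (Y →₀ V)) (z : ℂ) (x y : Y) :
    V →L[ℂ] V :=
  ∑' n : ℕ, (z ^ n / (n.factorial : ℂ)) • kernelOfL (D ^ n) x y

/-- The `Γ`-trace `tr_Γ e^{zD} = Σ_{s ∈ S} tr ⟨s|e^{zD}|s⟩`,
for a set `S` of representatives of the `Γ`-orbits. -/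
def trGammaHeat [FiniteDimensional ℂ V] (D : (Y →₀ V) →ₗ[ℂ] (Y →₀ V)) (z : ℂ)
    (S : Set Y) : ℂ :=
  ∑ᶠ s ∈ S, LinearMap.trace ℂ V ((heatKer D z s s : V →L[ℂ] V) : V →ₗ[ℂ] V)

/-- `tr e^{zT}` for an endomorphism `T` of a finite dimensional space,
via the exponential series `Σ_{n ≥ 0} (zⁿ/n!) tr(Tⁿ)`. -/
def trExp {W : Type*} [AddCommGroup W] [Module ℂ W] (T : W →ₗ[ℂ] W) (z : ℂ) : ℂ :=
  ∑' n : ℕ, z ^ n / (n.factorial : ℂ) * LinearMap.trace ℂ W (T ^ n)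

end Defs

section Auxiliary

/-- Absolute convergence of an exponential double series with geometrically growing
coefficients. -/
lemma summable_pow_div_factorial_mul_prod {β : Type*} {a : ℕ → β → ℂ} {g : ℕ → β → ℝ} {M C : ℝ}
    (hag : ∀ n x, ‖a n x‖ ≤ g n x) (hg : ∀ n, Summable (g n))
    (hgC : ∀ n, ∑' x, g n x ≤ M * C ^ n) (z : ℂ) :
    Summable fun x : ℕ × β => (z ^ x.1 / (x.1.factorial : ℂ)) * a x.1 x.2 := by
  have hg0 (n : ℕ) (x : β) : 0 ≤ g n x := (norm_nonneg _).trans (hag n x)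
  refine Summable.of_norm_bounded
    (g := fun x : ℕ × β => ‖z ^ x.1 / (x.1.factorial : ℂ)‖ * g x.1 x.2) ?_ fun x => ?_
  · rw [summable_prod_of_nonneg fun x => mul_nonneg (norm_nonneg _) (hg0 _ _)]
    dsimp only
    refine ⟨fun n => (hg n).mul_left ‖z ^ n / (n.factorial : ℂ)‖, ?_⟩
    refine Summable.of_nonneg_of_le
      (fun n => tsum_nonneg fun x => mul_nonneg (norm_nonneg _) (hg0 _ _)) (fun n => ?_)
      ((Real.summable_pow_div_factorial (‖z‖ * C)).mul_left M)
    rw [tsum_mul_left]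
    refine (mul_le_mul_of_nonneg_left (hgC n) (norm_nonneg _)).trans_eq ?_
    rw [norm_div, norm_pow, Complex.norm_natCast, mul_pow]
    ring
  · rw [norm_mul]
    exact mul_le_mul_of_nonneg_left (hag _ _) (norm_nonneg _)

lemma IsRepSet.finite [Group Γ] [MulAction Γ Y] {S : Set Y} (hS : IsRepSet Γ S)
    (horb : Finite (MulAction.orbitRel.Quotient Γ Y)) : S.Finite := by
  have hinj : Function.Injective fun s : S => (⟦s.1⟧ : MulAction.orbitRel.Quotient Γ Y) := by
    intro s t hst
    have h : s.1 ∈ MulAction.orbit Γ t.1 := MulAction.orbitRel_apply.1 (Quotient.exact hst)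
    exact Subtype.ext ((hS t).unique ⟨s.2, h⟩ ⟨t.2, MulAction.mem_orbit_self _⟩)
  exact Set.finite_coe_iff.1 (Finite.of_injective _ hinj)

/-- Translates of representatives of the `Γ`-orbits by representatives of the cosets of a normal
subgroup `Γ'` meet every `Γ'`-orbit. -/
lemma IsRepSet.exists_eq_smul_out [Group Γ] [MulAction Γ Y] {S : Set Y} (hS : IsRepSet Γ S)
    (Γ' : Subgroup Γ) [hnorm : Γ'.Normal] (y : Y) :
    ∃ i : S × (Γ ⧸ Γ'), ∃ γ : Γ', y = (γ : Γ) • i.2.out • i.1.1 := by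
  obtain ⟨s, ⟨hs, g, hg⟩, -⟩ := hS y
  obtain ⟨h, hh⟩ := QuotientGroup.mk_out_eq_mul Γ' g⁻¹
  refine ⟨(⟨s, hs⟩, (g⁻¹ : Γ)), ⟨_, hnorm.conj_mem _ (Γ'.inv_mem h.2) (g⁻¹ : Γ)⟩, ?_⟩
  rw [hh]
  change y = _ • _ • s
  rw [← hg]
  simp [smul_smul, mul_assoc]

/-- Translates of representatives of the `Γ`-orbits by representatives of the cosets of a normal
subgroup `Γ'` lie in distinct `Γ'`-orbits. -/
lemma IsRepSet.eq_of_smul_out_eq [Group Γ] [MulAction Γ Y] {S : Set Y} (hS : IsRepSet Γ S)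
    (hfree : ∀ (γ : Γ) (y : Y), γ • y = y → γ = 1) (Γ' : Subgroup Γ) [hnorm : Γ'.Normal]
    (i j : S × (Γ ⧸ Γ')) (γ : Γ') (h : (γ : Γ) • j.2.out • j.1.1 = i.2.out • i.1.1) : i = j := by
  obtain ⟨s, q⟩ := i
  obtain ⟨t, r⟩ := j
  have hst : t = s := by
    refine Subtype.ext ((hS s).unique ⟨t.2, r.out⁻¹ * ((γ : Γ)⁻¹ * q.out), ?_⟩
      ⟨s.2, MulAction.mem_orbit_self _⟩)
    change _ • s.1 = t.1
    rw [mul_smul, mul_smul, ← h, inv_smul_smul, inv_smul_smul]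
  subst hst
  have hqr : r.out⁻¹ * ((γ : Γ)⁻¹ * q.out) = 1 := hfree _ t.1 (by
    rw [mul_smul, mul_smul, ← h, inv_smul_smul, inv_smul_smul])
  refine Prod.ext rfl ?_
  have hq : q.out = γ * r.out := by rw [inv_mul_eq_one] at hqr; rw [hqr, mul_inv_cancel_left]
  change q = r
  rw [← q.out_eq', ← r.out_eq', hq]
  refine QuotientGroup.eq.2 ?_
  simpa [mul_assoc] using hnorm.conj_mem _ (Γ'.inv_mem γ.2) r.out⁻¹

variable [NormedAddCommGroup V]

/-- The `ℓ¹`-norm of a finitely supported section. -/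
def l1Norm (φ : Y →₀ V) : ℝ := ∑' y, ‖φ y‖

lemma summable_norm_section (φ : Y →₀ V) : Summable fun y => ‖φ y‖ :=
  summable_of_hasFiniteSupport <| φ.support.finite_toSet.subset fun y hy => by
    simpa using hy

lemma l1Norm_nonneg (φ : Y →₀ V) : 0 ≤ l1Norm φ := tsum_nonneg fun _ => norm_nonneg _

lemma norm_apply_le_l1Norm (φ : Y →₀ V) (y : Y) : ‖φ y‖ ≤ l1Norm φ :=
  (summable_norm_section φ).le_tsum y fun _ _ => norm_nonneg _

lemma l1Norm_add_le (φ ψ : Y →₀ V) : l1Norm (φ + ψ) ≤ l1Norm φ + l1Norm ψ := by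
  unfold l1Norm
  rw [← (summable_norm_section φ).tsum_add (summable_norm_section ψ)]
  exact (summable_norm_section _).tsum_le_tsum (fun y => norm_add_le _ _)
    ((summable_norm_section φ).add (summable_norm_section ψ))

lemma l1Norm_zero : l1Norm (0 : Y →₀ V) = 0 := by simp [l1Norm]

lemma l1Norm_sum_le {ι : Type*} (s : Finset ι) (φ : ι → Y →₀ V) :
    l1Norm (∑ i ∈ s, φ i) ≤ ∑ i ∈ s, l1Norm (φ i) :=
  Finset.le_sum_of_subadditive l1Norm l1Norm_zero.le l1Norm_add_le s φ

lemma l1Norm_single (y : Y) (v : V) : l1Norm (Finsupp.single y v) = ‖v‖ := by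
  classical
  unfold l1Norm
  rw [tsum_eq_single y]
  · simp
  · intro x hx
    simp [Finsupp.single_eq_of_ne hx]

lemma l1Norm_eq_sum (φ : Y →₀ V) : l1Norm φ = ∑ y ∈ φ.support, ‖φ y‖ :=
  tsum_eq_sum fun y hy => by simpa using hy

variable [InnerProductSpace ℂ V]

lemma l1Norm_smul (c : ℂ) (φ : Y →₀ V) : l1Norm (c • φ) = ‖c‖ * l1Norm φ := by
  simp only [l1Norm, Finsupp.smul_apply, norm_smul, tsum_mul_left]

variable {D : (Y →₀ V) →ₗ[ℂ] (Y →₀ V)}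

lemma l1Norm_pow_le {C : ℝ} (hC0 : 0 ≤ C) (hC : ∀ φ, l1Norm (D φ) ≤ C * l1Norm φ) (n : ℕ)
    (φ : Y →₀ V) : l1Norm ((D ^ n) φ) ≤ C ^ n * l1Norm φ := by
  induction n with
  | zero => simp
  | succ n ih =>
    rw [pow_succ', Module.End.mul_apply, pow_succ', mul_assoc]
    exact (hC _).trans (mul_le_mul_of_nonneg_left ih hC0)

section FiniteDimensional

variable [FiniteDimensional ℂ V] [Group Γ] {ρ : Γ →* (V ≃ₗᵢ[ℂ] V)}

/-- A linear map out of a finite-dimensional space is `ℓ¹`-bounded. -/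
lemma exists_l1Norm_le (T : V →ₗ[ℂ] (Y →₀ V)) : ∃ C, 0 ≤ C ∧ ∀ v, l1Norm (T v) ≤ C * ‖v‖ := by
  let b := stdOrthonormalBasis ℂ V
  refine ⟨∑ i, l1Norm (T (b i)), Finset.sum_nonneg fun i _ => l1Norm_nonneg _, fun v => ?_⟩
  calc l1Norm (T v) = l1Norm (∑ i, inner ℂ (b i) v • T (b i)) := by
        conv_lhs => rw [← b.sum_repr' v]
        simp only [map_sum, map_smul]
    _ ≤ ∑ i, l1Norm (inner ℂ (b i) v • T (b i)) := l1Norm_sum_le _ _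
    _ ≤ ∑ i, l1Norm (T (b i)) * ‖v‖ := by
        refine Finset.sum_le_sum fun i _ => ?_
        rw [l1Norm_smul, mul_comm]
        refine mul_le_mul_of_nonneg_left ?_ (l1Norm_nonneg _)
        simpa using norm_inner_le_norm (𝕜 := ℂ) (b i) v
    _ = _ := by rw [Finset.sum_mul]

/-- The functional `A ↦ tr(ρ(γ)⁻¹ A)` on `End(V)`. -/
def twistedTrace (ρ : Γ →* (V ≃ₗᵢ[ℂ] V)) (γ : Γ) : (V →ₗ[ℂ] V) →ₗ[ℂ] ℂ :=
  LinearMap.trace ℂ V ∘ₗ LinearMap.llcomp ℂ V V V (ρ γ⁻¹).toLinearEquiv.toLinearMap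

lemma twistedTrace_eq_sum (γ : Γ) (A : V →ₗ[ℂ] V) :
    twistedTrace ρ γ A = ∑ i, inner ℂ (stdOrthonormalBasis ℂ V i)
      (ρ γ⁻¹ (A (stdOrthonormalBasis ℂ V i))) :=
  LinearMap.trace_eq_sum_inner _ _

lemma norm_twistedTrace_le (γ : Γ) (A : V →ₗ[ℂ] V) :
    ‖twistedTrace ρ γ A‖ ≤ ∑ i, ‖A (stdOrthonormalBasis ℂ V i)‖ := by
  rw [twistedTrace_eq_sum]
  refine (norm_sum_le _ _).trans (Finset.sum_le_sum fun i _ => ?_)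
  simpa using norm_inner_le_norm (𝕜 := ℂ) (stdOrthonormalBasis ℂ V i)
    (ρ γ⁻¹ (A (stdOrthonormalBasis ℂ V i)))

/-- The heat kernel series converges when `D` is `ℓ¹`-bounded. -/
lemma hasSum_heatKer {C : ℝ} (hC0 : 0 ≤ C) (hC : ∀ φ, l1Norm (D φ) ≤ C * l1Norm φ) (z : ℂ)
    (x y : Y) :
    HasSum (fun n : ℕ => (z ^ n / (n.factorial : ℂ)) • kernelOfL (D ^ n) x y)
      (heatKer D z x y) := by
  refine (Summable.of_norm_bounded (Real.summable_pow_div_factorial (‖z‖ * C)) fun n => ?_).hasSum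
  have hk : ‖kernelOfL (D ^ n) x y‖ ≤ C ^ n :=
    ContinuousLinearMap.opNorm_le_bound _ (pow_nonneg hC0 n) fun v => by
      refine (norm_apply_le_l1Norm ((D ^ n) (Finsupp.single y v)) x).trans ?_
      simpa [l1Norm_single] using l1Norm_pow_le hC0 hC n (Finsupp.single y v)
  rw [norm_smul, norm_div, norm_pow, Complex.norm_natCast, mul_pow, div_mul_eq_mul_div]
  gcongr

lemma hasSum_twistedTrace_heatKer {C : ℝ} (hC0 : 0 ≤ C)
    (hC : ∀ φ, l1Norm (D φ) ≤ C * l1Norm φ) (z : ℂ) (γ : Γ) (x y : Y) :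
    HasSum (fun n : ℕ => (z ^ n / (n.factorial : ℂ)) * twistedTrace ρ γ (kernelOf (D ^ n) x y))
      (twistedTrace ρ γ ((heatKer D z x y : V →L[ℂ] V) : V →ₗ[ℂ] V)) := by
  let L : (V →L[ℂ] V) →ₗ[ℂ] ℂ := twistedTrace ρ γ ∘ₗ ContinuousLinearMap.coeLM ℂ
  have h := L.toContinuousLinearMap.hasSum (hasSum_heatKer hC0 hC z x y)
  convert! h using 2 with n
  rw [map_smul, smul_eq_mul]
  rfl

end FiniteDimensional

variable [Group Γ] [MulAction Γ Y] {ρ : Γ →* (V ≃ₗᵢ[ℂ] V)}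

lemma rho_apply_rho_apply (γ δ : Γ) (v : V) : ρ γ (ρ δ v) = ρ (γ * δ) v := by
  rw [map_mul]; rfl

lemma secAct_apply (γ : Γ) (φ : Y →₀ V) (y : Y) :
    secAct ρ γ φ y = ρ γ (φ (γ⁻¹ • y)) := by
  simp [secAct, Finsupp.equivMapDomain_apply]

lemma secAct_single (γ : Γ) (y : Y) (v : V) :
    secAct ρ γ (Finsupp.single y v) = Finsupp.single (γ • y) (ρ γ v) := by
  simp [secAct, Finsupp.equivMapDomain_single]

lemma l1Norm_secAct (γ : Γ) (φ : Y →₀ V) : l1Norm (secAct ρ γ φ) = l1Norm φ := by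
  simp only [l1Norm, secAct_apply, LinearIsometryEquiv.norm_map]
  exact (MulAction.toPerm (α := Γ) (β := Y) γ⁻¹).tsum_eq fun y => ‖φ y‖

lemma IsEquivariantOp.pow (h : IsEquivariantOp ρ D) (n : ℕ) : IsEquivariantOp ρ (D ^ n) := by
  induction n with
  | zero => intro γ φ; simp
  | succ n ih => intro γ φ; simp only [pow_succ, Module.End.mul_apply, h γ φ, ih γ]

lemma IsEquivariantOp.kernelOf_smul (h : IsEquivariantOp ρ D) (γ : Γ) (x y : Y) :
    kernelOf D (γ • x) (γ • y) =
      (ρ γ).toLinearEquiv.toLinearMap ∘ₗ kernelOf D x y ∘ₗ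
        (ρ γ⁻¹).toLinearEquiv.toLinearMap := by
  ext v
  have h1 := DFunLike.congr_fun (h γ (Finsupp.single y (ρ γ⁻¹ v))) (γ • x)
  have h2 : ρ γ (ρ γ⁻¹ v) = v := by
    rw [rho_apply_rho_apply]; simp
  rw [secAct_apply, secAct_single, h2, inv_smul_smul] at h1
  simpa [kernelOf] using h1

variable {Γ' : Subgroup Γ}

lemma injective_smul_of_free (hfree : ∀ (γ : Γ) (y : Y), γ • y = y → γ = 1) (y : Y) :
    Function.Injective fun γ : Γ' => (γ : Γ) • y := by
  intro γ δ hγδ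
  have h := hfree ((δ : Γ)⁻¹ * γ) y (by
    rw [mul_smul, inv_smul_eq_iff]; exact hγδ)
  exact Subtype.ext (inv_mul_eq_one.1 h).symm

lemma finite_support_smap (hfree : ∀ (γ : Γ) (y : Y), γ • y = y → γ = 1)
    (φ : Y →₀ V) (y : Y) :
    (Function.support fun γ : Γ' => ρ ((γ : Γ)⁻¹) (φ ((γ : Γ) • y))).Finite := by
  refine (φ.support.finite_toSet.preimage
    (injective_smul_of_free (Γ' := Γ') hfree y).injOn).subset fun γ hγ => ?_
  simpa using hγ

lemma hasSum_smap (hfree : ∀ (γ : Γ) (y : Y), γ • y = y → γ = 1) (φ : Y →₀ V) (y : Y) :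
    HasSum (fun γ : Γ' => ρ ((γ : Γ)⁻¹) (φ ((γ : Γ) • y))) (smap ρ Γ' φ y) := by
  have hf := finite_support_smap (ρ := ρ) (Γ' := Γ') hfree φ y
  unfold smap
  rw [← tsum_eq_finsum (L := SummationFilter.unconditional _) hf]
  exact (summable_of_hasFiniteSupport hf).hasSum

/-- The summation map `S_{Γ'}`, as a linear map into the equivariant functions. -/
def smapLinear (hfree : ∀ (γ : Γ) (y : Y), γ • y = y → γ = 1) (ρ : Γ →* (V ≃ₗᵢ[ℂ] V))
    (Γ' : Subgroup Γ) : (Y →₀ V) →ₗ[ℂ] equivSubmodule (Y := Y) ρ Γ' where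
  toFun φ := ⟨smap ρ Γ' φ, fun γ y => by
    have h1 := ((ρ (γ : Γ)).toContinuousLinearEquiv.toContinuousLinearMap.hasSum
      (hasSum_smap (ρ := ρ) (Γ' := Γ') hfree φ y))
    have h2 := (Equiv.mulRight γ).hasSum_iff.2 h1
    refine (hasSum_smap hfree φ ((γ : Γ) • y)).unique ?_
    convert! h2 using 2 with δ
    change _ = ρ (γ : Γ) (ρ ((δ * γ : Γ)⁻¹) (φ ((δ * γ : Γ) • y)))
    rw [rho_apply_rho_apply, smul_smul]
    simp [-map_inv, -map_mul]⟩
  map_add' φ ψ := Subtype.ext <| funext fun y =>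
    (hasSum_smap hfree _ y).unique <| by
      simpa using (hasSum_smap (ρ := ρ) (Γ' := Γ') hfree φ y).add (hasSum_smap hfree ψ y)
  map_smul' c φ := Subtype.ext <| funext fun y =>
    (hasSum_smap hfree _ y).unique <| by
      simpa using (hasSum_smap (ρ := ρ) (Γ' := Γ') hfree φ y).const_smul c

lemma IsPushdown.pow_apply (hfree : ∀ (γ : Γ) (y : Y), γ • y = y → γ = 1)
    {DG : equivSubmodule (Y := Y) ρ Γ' →ₗ[ℂ] equivSubmodule (Y := Y) ρ Γ'}
    (hDG : IsPushdown ρ Γ' D DG) (n : ℕ) (φ : Y →₀ V) :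
    (DG ^ n) (smapLinear hfree ρ Γ' φ) = smapLinear hfree ρ Γ' ((D ^ n) φ) := by
  induction n with
  | zero => simp
  | succ n ih =>
    rw [pow_succ', Module.End.mul_apply, ih, pow_succ', Module.End.mul_apply]
    exact Subtype.ext (hDG _ _ rfl)

/-- Evaluation of equivariant functions at a point. -/
def evalAt (ρ : Γ →* (V ≃ₗᵢ[ℂ] V)) (Γ' : Subgroup Γ) (y : Y) :
    equivSubmodule (Y := Y) ρ Γ' →ₗ[ℂ] V :=
  LinearMap.proj y ∘ₗ (equivSubmodule (Y := Y) ρ Γ').subtype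

/-- If `p` parametrizes a set of representatives of the `Γ'`-orbits, an equivariant function is
recovered from its values on the image of `p`. -/
lemma sum_smapLinear_single (hfree : ∀ (γ : Γ) (y : Y), γ • y = y → γ = 1)
    {ι : Type*} [Fintype ι] {p : ι → Y}
    (hp : ∀ y, ∃ i, ∃ γ : Γ', y = (γ : Γ) • p i)
    (hinj : ∀ i j, ∀ γ : Γ', (γ : Γ) • p j = p i → i = j)
    (w : equivSubmodule (Y := Y) ρ Γ') :
    ∑ i, smapLinear hfree ρ Γ' (Finsupp.single (p i) (evalAt ρ Γ' (p i) w)) = w := by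
  classical
  have key (j : ι) : evalAt ρ Γ' (p j)
      (∑ i, smapLinear hfree ρ Γ' (Finsupp.single (p i) (evalAt ρ Γ' (p i) w))) =
        evalAt ρ Γ' (p j) w := by
    rw [map_sum, Finset.sum_eq_single j]
    · refine (hasSum_smap hfree _ (p j)).unique ?_
      have h := hasSum_single (f := fun γ : Γ' => ρ ((γ : Γ)⁻¹)
        (Finsupp.single (p j) (evalAt ρ Γ' (p j) w) ((γ : Γ) • p j))) 1 fun γ hγ => by
          rw [Finsupp.single_eq_of_ne, map_zero]
          exact fun h => hγ (Subtype.ext (hfree _ _ h))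
      simpa using h
    · intro i _ hij
      refine (hasSum_smap hfree _ (p j)).unique ?_
      convert! hasSum_zero with γ
      rw [Finsupp.single_eq_of_ne, map_zero]
      intro h
      exact hij (hinj i j γ h)
    · simp
  ext y
  obtain ⟨i, γ, rfl⟩ := hp y
  refine ((∑ i, smapLinear hfree ρ Γ' (Finsupp.single (p i) (evalAt ρ Γ' (p i) w))).prop γ
    (p i)).trans (Eq.trans ?_ (w.prop γ (p i)).symm)
  exact congrArg (ρ (γ : Γ)) (key i)

variable [FiniteDimensional ℂ V]

lemma IsEquivariantOp.exists_l1Norm_le (h : IsEquivariantOp ρ D) {S : Set Y} (hS : IsRepSet Γ S)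
    (hfin : S.Finite) : ∃ C, 0 ≤ C ∧ ∀ φ, l1Norm (D φ) ≤ C * l1Norm φ := by
  choose c hc0 hc using fun y : Y => _root_.exists_l1Norm_le (D ∘ₗ Finsupp.lsingle (M := V) y)
  have hC0 : 0 ≤ ∑ s ∈ hfin.toFinset, c s := Finset.sum_nonneg fun s _ => hc0 s
  have hsingle (y : Y) (v : V) :
      l1Norm (D (Finsupp.single y v)) ≤ (∑ s ∈ hfin.toFinset, c s) * ‖v‖ := by
    obtain ⟨s, ⟨hsS, γ, hγ⟩, -⟩ := hS y
    have h1 := h γ (Finsupp.single y v)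
    rw [secAct_single, show γ • y = s from hγ] at h1
    rw [← l1Norm_secAct (ρ := ρ) γ, ← h1]
    refine (hc _ _).trans ?_
    rw [LinearIsometryEquiv.norm_map]
    exact mul_le_mul_of_nonneg_right
      (Finset.single_le_sum (fun s _ => hc0 s) (hfin.mem_toFinset.2 hsS)) (norm_nonneg _)
  refine ⟨_, hC0, fun φ => ?_⟩
  calc l1Norm (D φ) = l1Norm (∑ y ∈ φ.support, D (Finsupp.single y (φ y))) := by
        conv_lhs => rw [← φ.sum_single, Finsupp.sum, map_sum]
    _ ≤ ∑ y ∈ φ.support, l1Norm (D (Finsupp.single y (φ y))) := l1Norm_sum_le _ _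
    _ ≤ ∑ y ∈ φ.support, (∑ s ∈ hfin.toFinset, c s) * ‖φ y‖ :=
        Finset.sum_le_sum fun y _ => hsingle y _
    _ = _ := by rw [l1Norm_eq_sum, Finset.mul_sum]

/-- Conjugation invariance of the twisted traces of an invariant kernel. -/
lemma IsEquivariantOp.twistedTrace_kernelOf (h : IsEquivariantOp ρ D) (g γ : Γ) (s : Y) :
    twistedTrace ρ γ (kernelOf D (γ • g • s) (g • s)) =
      twistedTrace ρ (g⁻¹ * γ * g) (kernelOf D ((g⁻¹ * γ * g) • s) s) := by
  have h1 : γ • g • s = g • (g⁻¹ * γ * g) • s := by simp [smul_smul, mul_assoc]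
  rw [h1, h.kernelOf_smul]
  change LinearMap.trace ℂ V (_ ∘ₗ _ ∘ₗ _) = LinearMap.trace ℂ V (_ ∘ₗ _)
  rw [← LinearMap.comp_assoc, ← LinearMap.comp_assoc, LinearMap.trace_comp_comm',
    ← LinearMap.comp_assoc, ← LinearMap.comp_assoc]
  congr 2
  ext v
  simp [-map_inv, -map_mul, rho_apply_rho_apply, mul_assoc]

lemma hasSum_twistedTrace_kernelOf (hfree : ∀ (γ : Γ) (y : Y), γ • y = y → γ = 1) (y : Y) :
    HasSum (fun γ : Γ' => twistedTrace ρ (γ : Γ) (kernelOf D ((γ : Γ) • y) y))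
      (LinearMap.trace ℂ V
        (evalAt ρ Γ' y ∘ₗ smapLinear hfree ρ Γ' ∘ₗ D ∘ₗ Finsupp.lsingle y)) := by
  rw [LinearMap.trace_eq_sum_inner _ (stdOrthonormalBasis ℂ V)]
  simp only [twistedTrace_eq_sum]
  refine hasSum_sum fun i _ => ?_
  exact (innerSL ℂ (stdOrthonormalBasis ℂ V i)).hasSum
    (hasSum_smap hfree (D (Finsupp.single y (stdOrthonormalBasis ℂ V i))) y)

/-- The trace of a power of the pushdown, as a sum over representatives of the `Γ'`-orbits. -/
lemma IsPushdown.trace_pow (hfree : ∀ (γ : Γ) (y : Y), γ • y = y → γ = 1)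
    {DG : equivSubmodule (Y := Y) ρ Γ' →ₗ[ℂ] equivSubmodule (Y := Y) ρ Γ'}
    (hDG : IsPushdown ρ Γ' D DG) {ι : Type*} [Fintype ι] {p : ι → Y}
    (hp : ∀ y, ∃ i, ∃ γ : Γ', y = (γ : Γ) • p i)
    (hinj : ∀ i j, ∀ γ : Γ', (γ : Γ) • p j = p i → i = j) (n : ℕ) :
    LinearMap.trace ℂ _ (DG ^ n) = ∑ i, ∑' γ : Γ',
      twistedTrace ρ (γ : Γ) (kernelOf (D ^ n) ((γ : Γ) • p i) (p i)) := by
  have hfd : FiniteDimensional ℂ (equivSubmodule (Y := Y) ρ Γ') := by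
    refine FiniteDimensional.of_injective (LinearMap.pi fun i => evalAt ρ Γ' (p i))
      fun w w' h => ?_
    rw [← sum_smapLinear_single hfree hp hinj w, ← sum_smapLinear_single hfree hp hinj w']
    exact Finset.sum_congr rfl fun i _ => by
      rw [show evalAt ρ Γ' (p i) w = evalAt ρ Γ' (p i) w' from congrFun h i]
  have hdecomp : DG ^ n = ∑ i, ((DG ^ n) ∘ₗ smapLinear hfree ρ Γ' ∘ₗ Finsupp.lsingle (p i)) ∘ₗ
      evalAt ρ Γ' (p i) := by
    refine LinearMap.ext fun w => ?_
    conv_lhs => rw [← sum_smapLinear_single hfree hp hinj w, map_sum]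
    rw [LinearMap.sum_apply]
    rfl
  rw [hdecomp, map_sum]
  refine Finset.sum_congr rfl fun i _ => ?_
  rw [LinearMap.trace_comp_comm', (hasSum_twistedTrace_kernelOf hfree (p i)).tsum_eq]
  congr 1
  ext v : 1
  exact congrArg (evalAt ρ Γ' (p i)) (hDG.pow_apply hfree n _)

/-- The double series over `n` and `γ` of twisted traces converges absolutely. -/
lemma summable_twistedTrace_kernelOf (hfree : ∀ (γ : Γ) (y : Y), γ • y = y → γ = 1)
    (Γ' : Subgroup Γ) {C : ℝ} (hC0 : 0 ≤ C) (hC : ∀ φ, l1Norm (D φ) ≤ C * l1Norm φ) (z : ℂ)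
    (s : Y) :
    Summable fun x : ℕ × Γ' => (z ^ x.1 / (x.1.factorial : ℂ)) *
      twistedTrace ρ (x.2 : Γ) (kernelOf (D ^ x.1) ((x.2 : Γ) • s) s) := by
  let b := stdOrthonormalBasis ℂ V
  let ψ (n : ℕ) i : Y →₀ V := (D ^ n) (Finsupp.single s (b i))
  have hinj := injective_smul_of_free (Γ' := Γ') hfree s
  have hsum (n : ℕ) : Summable fun γ : Γ' => ∑ i, ‖ψ n i ((γ : Γ) • s)‖ :=
    summable_sum fun i _ => (summable_norm_section (ψ n i)).comp_injective hinj
  refine summable_pow_div_factorial_mul_prod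
    (a := fun n (γ : Γ') => twistedTrace ρ (γ : Γ) (kernelOf (D ^ n) ((γ : Γ) • s) s))
    (fun n γ => norm_twistedTrace_le _ _) hsum
    (M := Module.finrank ℂ V) (C := C) (fun n => ?_) z
  refine (Summable.tsum_finsetSum fun i _ =>
    (summable_norm_section (ψ n i)).comp_injective hinj).trans_le ?_
  calc _ ≤ ∑ i : Fin (Module.finrank ℂ V), C ^ n := Finset.sum_le_sum fun i _ => ?_
    _ = _ := by simp
  refine (tsum_comp_le_tsum_of_inj (summable_norm_section (ψ n i))
    (fun _ => norm_nonneg _) hinj).trans ?_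
  change l1Norm ((D ^ n) (Finsupp.single s (b i))) ≤ C ^ n
  simpa [l1Norm_single] using l1Norm_pow_le hC0 hC n (Finsupp.single s (b i))

/-- Summing the twisted traces over `n` first or over `γ` first gives the same result. -/
lemma hasSum_tsum_twistedTrace_kernelOf (hfree : ∀ (γ : Γ) (y : Y), γ • y = y → γ = 1)
    (Γ' : Subgroup Γ) {C : ℝ} (hC0 : 0 ≤ C) (hC : ∀ φ, l1Norm (D φ) ≤ C * l1Norm φ) (z : ℂ)
    (s : Y) :
    HasSum (fun n : ℕ => (z ^ n / (n.factorial : ℂ)) *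
      ∑' γ : Γ', twistedTrace ρ (γ : Γ) (kernelOf (D ^ n) ((γ : Γ) • s) s))
      (∑' γ : Γ', twistedTrace ρ (γ : Γ)
        ((heatKer D z ((γ : Γ) • s) s : V →L[ℂ] V) : V →ₗ[ℂ] V)) := by
  have h := summable_twistedTrace_kernelOf (ρ := ρ) hfree Γ' hC0 hC z s
  have h2 := h.prod.hasSum
  dsimp only at h2
  rw [← Summable.tsum_comm (f := fun (n : ℕ) (γ : Γ') => (z ^ n / (n.factorial : ℂ)) *
    twistedTrace ρ (γ : Γ) (kernelOf (D ^ n) ((γ : Γ) • s) s)) h] at h2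
  simp only [tsum_mul_left] at h2
  convert! h2 using 3 with γ
  exact (hasSum_twistedTrace_heatKer hC0 hC z _ _ _).tsum_eq.symm

lemma summable_twistedTrace_heatKer (hfree : ∀ (γ : Γ) (y : Y), γ • y = y → γ = 1)
    (Γ' : Subgroup Γ) {C : ℝ} (hC0 : 0 ≤ C) (hC : ∀ φ, l1Norm (D φ) ≤ C * l1Norm φ) (z : ℂ)
    (s : Y) :
    Summable fun γ : Γ' => twistedTrace ρ (γ : Γ)
        ((heatKer D z ((γ : Γ) • s) s : V →L[ℂ] V) : V →ₗ[ℂ] V) := by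
  have h := (summable_twistedTrace_kernelOf (ρ := ρ) hfree Γ' hC0 hC z s).prod_symm.prod
  simpa only [Prod.fst_swap, Prod.snd_swap,
    (hasSum_twistedTrace_heatKer hC0 hC z _ _ _).tsum_eq] using h

/-- The trace of a power of the pushdown to a normal subgroup, as a sum over representatives of
the `Γ`-orbits. -/
lemma IsPushdown.trace_pow_eq_index_mul (hfree : ∀ (γ : Γ) (y : Y), γ • y = y → γ = 1)
    (hinv : IsEquivariantOp ρ D) [Γ'.Normal] [Γ'.FiniteIndex]
    {DG : equivSubmodule (Y := Y) ρ Γ' →ₗ[ℂ] equivSubmodule (Y := Y) ρ Γ'}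
    (hDG : IsPushdown ρ Γ' D DG) {S : Set Y} [Fintype S] (hS : IsRepSet Γ S) (n : ℕ) :
    LinearMap.trace ℂ _ (DG ^ n) = (Γ'.index : ℂ) * ∑ s : S, ∑' γ : Γ',
      twistedTrace ρ (γ : Γ) (kernelOf (D ^ n) ((γ : Γ) • s.1) s.1) := by
  have := Fintype.ofFinite (Γ ⧸ Γ')
  rw [hDG.trace_pow hfree (hS.exists_eq_smul_out Γ') (hS.eq_of_smul_out_eq hfree Γ') n,
    Fintype.sum_prod_type, Finset.mul_sum]
  refine Finset.sum_congr rfl fun s _ => ?_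
  rw [Subgroup.index_eq_card, Nat.card_eq_fintype_card, ← Finset.card_univ, ← nsmul_eq_mul]
  refine Finset.sum_eq_card_nsmul fun q _ => ?_
  rw [← (MulAut.conjNormal q.out : MulAut Γ').toEquiv.tsum_eq]
  refine tsum_congr fun γ => ?_
  rw [(hinv.pow n).twistedTrace_kernelOf]
  simp [mul_assoc]

end Auxiliary

/-- Let `D` be `Γ`-invariant of finite propagation speed, `Γ'` a finite-index
normal subgroup, `S` a set of representatives of the `Γ`-orbits, `z ∈ ℂ`.  Then
`tr e^{zD_{Γ'}} = [Γ:Γ'] Σ_{s∈S} Σ_{γ∈Γ'} tr(ρ(γ)⁻¹ ⟨γs|e^{zD}|s⟩)` and hence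
`tr e^{zD_{Γ'}}/[Γ:Γ'] − tr_Γ e^{zD}
  = Σ_{s∈S} Σ_{γ∈Γ', γ≠1} tr(ρ(γ)⁻¹ ⟨γs|e^{zD}|s⟩)`. -/
theorem pushdown_heat_trace_formula
    [MetricSpace Y] [Group Γ] [MulAction Γ Y]
    [NormedAddCommGroup V] [InnerProductSpace ℂ V] [FiniteDimensional ℂ V]
    (hball : ∀ (y : Y) (R : ℝ), (Metric.closedBall y R).Finite)
    (hiso : ∀ γ : Γ, Isometry (fun y : Y => γ • y))
    (hfree : ∀ (γ : Γ) (y : Y), γ • y = y → γ = 1)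
    (horb : Finite (MulAction.orbitRel.Quotient Γ Y))
    (ρ : Γ →* (V ≃ₗᵢ[ℂ] V))
    (D : (Y →₀ V) →ₗ[ℂ] (Y →₀ V))
    (hinv : IsEquivariantOp ρ D)
    (hprop : ∃ R : ℝ, HasPropSpeed D R)
    (Γ' : Subgroup Γ) (hnorm : Γ'.Normal) (hfi : Γ'.FiniteIndex)
    (DG : equivSubmodule (Y := Y) ρ Γ' →ₗ[ℂ] equivSubmodule (Y := Y) ρ Γ')
    (hDG : IsPushdown ρ Γ' D DG)
    (S : Set Y) (hS : IsRepSet Γ S) (z : ℂ) :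
    trExp DG z =
      (Γ'.index : ℂ) * ∑ᶠ s ∈ S, ∑' γ : Γ',
        LinearMap.trace ℂ V
          ((ρ ((γ : Γ)⁻¹)).toLinearEquiv.toLinearMap ∘ₗ
            ((heatKer D z ((γ : Γ) • s) s : V →L[ℂ] V) : V →ₗ[ℂ] V)) ∧
    trExp DG z / (Γ'.index : ℂ) - trGammaHeat D z S =
      ∑ᶠ s ∈ S, ∑' γ : {γ : Γ' // γ ≠ 1},
        LinearMap.trace ℂ V
          ((ρ (((γ : Γ') : Γ))⁻¹).toLinearEquiv.toLinearMap ∘ₗ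
            ((heatKer D z (((γ : Γ') : Γ) • s) s : V →L[ℂ] V) : V →ₗ[ℂ] V)) := by
  have hfin : S.Finite := hS.finite horb
  have : Fintype S := hfin.fintype
  obtain ⟨C, hC0, hC⟩ := hinv.exists_l1Norm_le hS hfin
  have hconv (f : Y → ℂ) : ∑ᶠ s ∈ S, f s = ∑ s : S, f s := by
    rw [← finsum_set_coe_eq_finsum_mem, finsum_eq_sum_of_fintype]
  have hmain : trExp DG z = (Γ'.index : ℂ) * ∑ s : S, ∑' γ : Γ', twistedTrace ρ (γ : Γ)
      ((heatKer D z ((γ : Γ) • s.1) s.1 : V →L[ℂ] V) : V →ₗ[ℂ] V) := by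
    refine HasSum.tsum_eq ?_
    convert! (hasSum_sum (s := Finset.univ) fun (s : S) _ =>
      hasSum_tsum_twistedTrace_kernelOf (ρ := ρ) hfree Γ' hC0 hC z s.1).mul_left
        (Γ'.index : ℂ) using 2 with n
    rw [hDG.trace_pow_eq_index_mul hfree hinv hS n, ← Finset.mul_sum]
    ring
  have hidx : (Γ'.index : ℂ) ≠ 0 := Nat.cast_ne_zero.2 hfi.index_ne_zero
  refine ⟨by rw [hconv]; exact hmain, ?_⟩
  rw [hmain, mul_div_cancel_left₀ _ hidx, trGammaHeat, hconv, hconv, ← Finset.sum_sub_distrib]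
  refine Finset.sum_congr rfl fun s _ => ?_
  have hsplit := (summable_twistedTrace_heatKer (ρ := ρ) hfree Γ' hC0 hC z
    s.1).tsum_subtype_add_tsum_subtype_compl {1}
  rw [← hsplit, tsum_singleton (1 : Γ') fun γ : Γ' => twistedTrace ρ (γ : Γ)
    ((heatKer D z ((γ : Γ) • s.1) s.1 : V →L[ℂ] V) : V →ₗ[ℂ] V)]
  have hone : twistedTrace ρ ((1 : Γ') : Γ)
      ((heatKer D z (((1 : Γ') : Γ) • s.1) s.1 : V →L[ℂ] V) : V →ₗ[ℂ] V) =
      LinearMap.trace ℂ V ((heatKer D z s.1 s.1 : V →L[ℂ] V) : V →ₗ[ℂ] V) := by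
    simp only [OneMemClass.coe_one, one_smul, twistedTrace, inv_one, map_one]
    rfl
  rw [hone, add_sub_cancel_left]
  rfl
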